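/- Let (M_x) be the Poisson counting process with M_x ~ Poisson(-N log p_x) and T an independent geometric variable with P(T ≥ n) = e^{-βn}, β > 0. Then the randomised estimator Ẑ = ∫_0^∞ (1-1/N)^{M_x} 1_{T ≥ M_x}/P(T ≥ M_x) dx has second moment E[Ẑ^2] = 2∫_0^∞∫_0^x p_x p_{x'}^{1 − 1/γ(β,N)} dx' dx, where γ(β,N) = N/(1 + (e^β − 1)(N−1)^2). -/

import Mathlib

open MeasureTheory ProbabilityTheory Set

/-- The probability generating function of a Poisson variable, as an `ℝ≥0∞`-valued sum. -/
lemma tsum_poisson_mul_pow {r s : ℝ} (hr : 0 ≤ r) (hs : 0 ≤ s) :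
    ∑' k : ℕ, ENNReal.ofReal (Real.exp (-r) * r ^ k / (Nat.factorial k)) * ENNReal.ofReal (s ^ k)
      = ENNReal.ofReal (Real.exp (r * (s - 1))) := by
  have h : HasSum (fun k : ℕ => Real.exp (-r) * r ^ k / (Nat.factorial k) * s ^ k)
      (Real.exp (r * (s - 1))) := by
    have h1 := (NormedSpace.expSeries_div_hasSum_exp (r * s)).mul_left (Real.exp (-r))
    rw [← Real.exp_eq_exp_ℝ, ← Real.exp_add] at h1
    rw [show r * (s - 1) = -r + r * s by ring]
    exact (congrArg (HasSum · _) (funext fun k => by rw [mul_pow]; ring)).mpr h1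
  rw [← h.tsum_eq, ENNReal.ofReal_tsum_of_nonneg (fun k => by positivity) h.summable]
  exact tsum_congr fun k => (ENNReal.ofReal_mul (by positivity)).symm

/-- The tail of a geometric law, as an `ℝ≥0∞`-valued sum. -/
lemma tsum_geometric_tail {β : ℝ} (hβ : 0 < β) (m : ℕ) :
    ∑' n : ℕ, ENNReal.ofReal (Real.exp (-β * n) - Real.exp (-β * (n + 1)))
        * (if m ≤ n then 1 else 0)
      = ENNReal.ofReal (Real.exp (-β * m)) := by
  have hlt : Real.exp (-β) < 1 := Real.exp_lt_one_iff.2 (by linarith)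
  have h : HasSum (fun j : ℕ => Real.exp (-β * ((m + j : ℕ) : ℝ))
      - Real.exp (-β * (((m + j : ℕ) : ℝ) + 1))) (Real.exp (-β * m)) := by
    have h1 := (hasSum_geometric_of_lt_one (Real.exp_pos (-β)).le hlt).mul_left
      (Real.exp (-β * m) * (1 - Real.exp (-β)))
    rw [mul_assoc, mul_inv_cancel₀ (by linarith), mul_one] at h1
    refine (congrArg (HasSum · _) (funext fun j => ?_)).mpr h1
    rw [← Real.exp_nat_mul, mul_sub, mul_one, sub_mul, ← Real.exp_add, ← Real.exp_add,
      ← Real.exp_add]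
    push_cast
    congr 2 <;> ring_nf
  have hnn : ∀ j : ℕ, 0 ≤ Real.exp (-β * ((m + j : ℕ) : ℝ))
      - Real.exp (-β * (((m + j : ℕ) : ℝ) + 1)) := fun j =>
    sub_nonneg.2 (Real.exp_le_exp.2 (by nlinarith))
  rw [← h.tsum_eq, ENNReal.ofReal_tsum_of_nonneg hnn h.summable,
    ← (add_right_injective m).tsum_eq]
  · exact tsum_congr fun j => by simp
  · intro n hn
    by_cases hmn : m ≤ n
    · exact ⟨n - m, by simp [hmn]⟩
    · simp [hmn] at hn

/-- If disjoint measurable sets carry the whole mass of a probability measure and a function is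
constant on each of them, its integral is the corresponding weighted sum. -/
lemma lintegral_eq_tsum_of_partition {Ω ι : Type*} [MeasurableSpace Ω] [Countable ι]
    (μ : Measure Ω) [IsProbabilityMeasure μ] {A : ι → Set Ω} (hA : ∀ i, MeasurableSet (A i))
    (hdisj : Pairwise (Function.onFun Disjoint A)) (hsum : ∑' i, μ (A i) = 1)
    {F : Ω → ENNReal} {c : ι → ENNReal} (hF : ∀ i, ∀ ω ∈ A i, F ω = c i) :
    ∫⁻ ω, F ω ∂μ = ∑' i, μ (A i) * c i := by
  have hU : ∀ᵐ ω ∂μ, ω ∈ ⋃ i, A i := by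
    rw [← measure_iUnion hdisj hA] at hsum
    exact (prob_compl_eq_zero_iff (MeasurableSet.iUnion hA)).2 hsum
  rw [← Measure.restrict_eq_self_of_ae_mem hU, lintegral_iUnion hA hdisj,
    Measure.restrict_eq_self_of_ae_mem hU]
  refine tsum_congr fun i => ?_
  rw [setLIntegral_congr_fun (hA i) (hF i), setLIntegral_const, mul_comm]

/-- The integral of a symmetric kernel over `(0, ∞)²` is twice the one over `{y < x}`. -/
lemma lintegral_Ioi_Ioi_eq_two_mul {g : ℝ → ℝ → ENNReal}
    (hg : Measurable (fun q : ℝ × ℝ => g q.1 q.2)) (hsymm : ∀ x y, g x y = g y x) :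
    ∫⁻ x in Ioi (0 : ℝ), ∫⁻ y in Ioi (0 : ℝ), g x y
      = 2 * ∫⁻ x in Ioi (0 : ℝ), ∫⁻ y in Ioo (0 : ℝ) x, g x y := by
  have hlt : MeasurableSet {q : ℝ × ℝ | q.2 < q.1} := measurableSet_lt measurable_snd measurable_fst
  set u : ℝ → ℝ → ENNReal := fun x y => {q : ℝ × ℝ | q.2 < q.1}.indicator (fun q => g q.1 q.2) (x, y)
    with hu
  have hum : Measurable (fun q : ℝ × ℝ => u q.1 q.2) := hg.indicator hlt
  have hinner : ∀ x ∈ Ioi (0 : ℝ), ∫⁻ y in Ioi (0 : ℝ), u x y = ∫⁻ y in Ioo (0 : ℝ) x, g x y := by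
    intro x _
    have : ∀ y, u x y = (Iio x).indicator (g x) y := fun y => by simp [hu, indicator]
    simp_rw [this]
    rw [setLIntegral_indicator measurableSet_Iio, inter_comm]
    rfl
  have hsplit : ∀ x, ∫⁻ y in Ioi (0 : ℝ), g x y
      = (∫⁻ y in Ioi (0 : ℝ), u x y) + ∫⁻ y in Ioi (0 : ℝ), u y x := by
    intro x
    rw [← lintegral_add_left (f := fun y => u x y) (hum.comp measurable_prodMk_left)]
    refine lintegral_congr_ae (ae_restrict_of_ae ?_)
    filter_upwards [Measure.ae_ne volume x] with y hy
    rcases lt_or_gt_of_ne hy with h | h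
    · simp [hu, indicator, h, h.not_gt]
    · simp [hu, indicator, h, h.not_gt, hsymm x y]
  have hum' : Measurable (fun q : ℝ × ℝ => u q.2 q.1) := hum.comp measurable_swap
  simp_rw [hsplit]
  rw [lintegral_add_left hum.lintegral_prod_right',
    lintegral_lintegral_swap (f := fun x y => u y x) hum'.aemeasurable, ← two_mul,
    setLIntegral_congr_fun measurableSet_Ioi hinner]

/-- The second moment of an integral over `(0, ∞)` of a nonnegative process. -/
lemma lintegral_sq_lintegral_Ioi {Ω : Type*} [MeasurableSpace Ω] (μ : Measure Ω) [SFinite μ]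
    {f : ℝ → Ω → ENNReal} (hf : Measurable (fun q : ℝ × Ω => f q.1 q.2)) :
    ∫⁻ ω, (∫⁻ x in Ioi (0 : ℝ), f x ω) ^ 2 ∂μ
      = 2 * ∫⁻ x in Ioi (0 : ℝ), ∫⁻ y in Ioo (0 : ℝ) x, ∫⁻ ω, f x ω * f y ω ∂μ := by
  have h3 : Measurable (fun q : (ℝ × ℝ) × Ω => f q.1.1 q.2 * f q.1.2 q.2) :=
    (hf.comp ((measurable_fst.comp measurable_fst).prodMk measurable_snd)).mul
      (hf.comp ((measurable_snd.comp measurable_fst).prodMk measurable_snd))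
  rw [← lintegral_Ioi_Ioi_eq_two_mul (g := fun x y => ∫⁻ ω, f x ω * f y ω ∂μ)
    h3.lintegral_prod_right' (fun x y => by simp_rw [mul_comm])]
  have hω : ∀ ω, Measurable (fun x => f x ω) := fun ω => hf.comp measurable_prodMk_right
  have hsq : ∀ ω, (∫⁻ x in Ioi (0 : ℝ), f x ω) ^ 2
      = ∫⁻ x in Ioi (0 : ℝ), ∫⁻ y in Ioi (0 : ℝ), f x ω * f y ω := by
    intro ω
    simp_rw [lintegral_const_mul _ (hω ω)]
    rw [lintegral_mul_const _ (hω ω), sq]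
  simp_rw [hsq]
  rw [lintegral_lintegral_swap]
  · refine lintegral_congr fun x => ?_
    rw [lintegral_lintegral_swap]
    exact (h3.comp ((measurable_const.prodMk measurable_snd).prodMk measurable_fst)).aemeasurable
  · have h4 : Measurable (fun q : (Ω × ℝ) × ℝ => f q.1.2 q.1.1 * f q.2 q.1.1) :=
      h3.comp (((measurable_snd.comp measurable_fst).prodMk measurable_snd).prodMk
        (measurable_fst.comp measurable_fst))
    exact h4.lintegral_prod_right'.aemeasurable

/-- The mixed second moment of the randomised weights `c ^ K * 1_{K ≤ T} / P(T ≥ K)` at two times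
of a Poisson process, with counts `K` and `K + L`. -/
lemma lintegral_randomised_weight_mul {Ω : Type*} [MeasurableSpace Ω] (μ : Measure Ω)
    [IsProbabilityMeasure μ] {c β r s : ℝ} (hc : 0 ≤ c) (hβ : 0 < β) (hr : 0 ≤ r) (hs : 0 ≤ s)
    {K K' T : Ω → ℕ} (hK : Measurable K) (hK' : Measurable K') (hT : Measurable T)
    (hlaw : ∀ k l n : ℕ, μ {ω | K ω = k ∧ K' ω = k + l ∧ T ω = n} =
      ENNReal.ofReal (Real.exp (-r) * r ^ k / (Nat.factorial k))
        * ENNReal.ofReal (Real.exp (-s) * s ^ l / (Nat.factorial l))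
        * ENNReal.ofReal (Real.exp (-β * n) - Real.exp (-β * (n + 1)))) :
    ∫⁻ ω, ENNReal.ofReal (c ^ K' ω * (if K' ω ≤ T ω then 1 else 0) / Real.exp (-β * K' ω))
        * ENNReal.ofReal (c ^ K ω * (if K ω ≤ T ω then 1 else 0) / Real.exp (-β * K ω)) ∂μ
      = ENNReal.ofReal (Real.exp (r * (c ^ 2 * Real.exp β - 1)) * Real.exp (s * (c - 1))) := by
  have hgeom : ∑' n : ℕ, ENNReal.ofReal (Real.exp (-β * n) - Real.exp (-β * (n + 1))) = 1 := by
    simpa using tsum_geometric_tail hβ 0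
  have hpoi : ∀ {r : ℝ}, 0 ≤ r →
      ∑' k : ℕ, ENNReal.ofReal (Real.exp (-r) * r ^ k / (Nat.factorial k)) = 1 := fun hr => by
    simpa using tsum_poisson_mul_pow hr zero_le_one
  refine (lintegral_eq_tsum_of_partition μ
    (A := fun i : ℕ × ℕ × ℕ => {ω | K ω = i.1 ∧ K' ω = i.1 + i.2.1 ∧ T ω = i.2.2})
    (c := fun i => ENNReal.ofReal (c ^ (i.1 + i.2.1) * c ^ i.1
      * Real.exp (β * (i.1 + i.2.1)) * Real.exp (β * i.1))
      * (if i.1 + i.2.1 ≤ i.2.2 then 1 else 0)) ?_ ?_ ?_ ?_).trans ?_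
  · exact fun i => (hK (measurableSet_singleton _)).inter
      ((hK' (measurableSet_singleton _)).inter (hT (measurableSet_singleton _)))
  · rintro ⟨k, l, n⟩ ⟨k', l', n'⟩ hne
    refine Set.disjoint_left.2 ?_
    rintro ω ⟨h1, h2, h3⟩ ⟨h1', h2', h3'⟩
    refine hne ?_
    simp only [Prod.mk.injEq] at *
    omega
  · rw [ENNReal.tsum_prod']
    simp_rw [ENNReal.tsum_prod', hlaw, ENNReal.tsum_mul_left, hgeom, mul_one,
      ENNReal.tsum_mul_left, hpoi hs, mul_one, hpoi hr]
  · rintro ⟨k, l, n⟩ ω ⟨h1, h2, h3⟩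
    dsimp only at h1 h2 h3 ⊢
    rw [h1, h2, h3]
    by_cases h : k + l ≤ n
    · have h' : k ≤ n := by omega
      rw [if_pos h, if_pos h', if_pos h, ← ENNReal.ofReal_mul (by positivity), mul_one,
        neg_mul, neg_mul, Real.exp_neg, Real.exp_neg]
      push_cast
      rw [mul_one, mul_one, div_inv_eq_mul, div_inv_eq_mul]
      ring_nf
    · simp [h]
  · rw [ENNReal.tsum_prod', ENNReal.ofReal_mul (by positivity),
      ← tsum_poisson_mul_pow hr (s := c ^ 2 * Real.exp β) (by positivity),
      ← tsum_poisson_mul_pow hs hc, ← ENNReal.tsum_mul_right]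
    refine tsum_congr fun k => ?_
    rw [ENNReal.tsum_prod', ← ENNReal.tsum_mul_left]
    refine tsum_congr fun l => ?_
    simp_rw [hlaw]
    have hexp : (c ^ (k + l) * c ^ k * Real.exp (β * (k + l)) * Real.exp (β * k))
        * Real.exp (-β * ((k + l : ℕ) : ℝ)) = (c ^ 2 * Real.exp β) ^ k * c ^ l := by
      have : Real.exp (β * (k + l)) * Real.exp (-β * ((k + l : ℕ) : ℝ)) = 1 := by
        rw [← Real.exp_add]
        push_cast
        simp
      rw [mul_pow, ← Real.exp_nat_mul, mul_comm (k : ℝ) β]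
      linear_combination (c ^ (k + l) * c ^ k * Real.exp (β * k)) * this
    calc _ = ENNReal.ofReal (Real.exp (-r) * r ^ k / (Nat.factorial k))
          * ENNReal.ofReal (Real.exp (-s) * s ^ l / (Nat.factorial l))
          * ENNReal.ofReal (c ^ (k + l) * c ^ k * Real.exp (β * (k + l)) * Real.exp (β * k))
          * ∑' n : ℕ, ENNReal.ofReal (Real.exp (-β * n) - Real.exp (-β * (n + 1)))
            * (if k + l ≤ n then 1 else 0) := by
            rw [← ENNReal.tsum_mul_left]
            exact tsum_congr fun n => by ring
      _ = _ := by
            have hofReal := congrArg ENNReal.ofReal hexp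
            rw [ENNReal.ofReal_mul (by positivity),
              ENNReal.ofReal_mul (p := (c ^ 2 * Real.exp β) ^ k) (by positivity)] at hofReal
            rw [tsum_geometric_tail hβ, mul_assoc, hofReal]
            ring

/-- Let `(M_x)` be the Poisson counting process (`M_x ~ Poisson(-N log p_x)` with
independent increments) and `T` an independent geometric variable with
`P(T ≥ n) = e^{-βn}`, `β > 0`. The randomised estimator
`Ẑ = ∫_0^∞ (1-1/N)^{M_x} 1_{T ≥ M_x}/P(T ≥ M_x) dx` has second moment
`E[Ẑ²] = 2∫_0^∞∫_0^x p_x p_{x'}^{1 − 1/γ(β,N)} dx' dx`, where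
`γ(β,N) = N/(1 + (e^β − 1)(N−1)²)`. -/
theorem stmt_11 {Ω : Type*} [MeasureSpace Ω] [IsProbabilityMeasure (ℙ : Measure Ω)]
    (p : ℝ → ℝ) (hp0 : ∀ x, 0 ≤ p x) (hp1 : ∀ x, p x ≤ 1) (hmono : Antitone p)
    (N : ℕ) (hN : 2 ≤ N) (β : ℝ) (hβ : 0 < β)
    (M : ℝ → Ω → ℕ) (hM : Measurable (fun q : ℝ × Ω => M q.1 q.2))
    (T : Ω → ℕ) (hT : Measurable T)
    (hlaw : ∀ x' x : ℝ, 0 < x' → x' < x → 0 < p x → ∀ k l n : ℕ,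
      ℙ {ω | M x' ω = k ∧ M x ω = k + l ∧ T ω = n} =
        ENNReal.ofReal (Real.exp ((N:ℝ) * Real.log (p x'))
            * (-((N:ℝ) * Real.log (p x'))) ^ k / (Nat.factorial k))
        * ENNReal.ofReal (Real.exp ((N:ℝ) * Real.log (p x / p x'))
            * (-((N:ℝ) * Real.log (p x / p x'))) ^ l / (Nat.factorial l))
        * ENNReal.ofReal (Real.exp (-β * n) - Real.exp (-β * (n+1)))) :
    ∫⁻ ω, (∫⁻ x in Ioi (0:ℝ),
        (if p x = 0 then 0 else ENNReal.ofReal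
          ((1 - 1/(N:ℝ)) ^ (M x ω) * (if M x ω ≤ T ω then 1 else 0)
            / Real.exp (-β * (M x ω))))) ^ 2 ∂ℙ
      = 2 * (∫⁻ x in Ioi (0:ℝ), ∫⁻ y in Ioo (0:ℝ) x,
          ENNReal.ofReal (p x * p y
            ^ (1 - 1/((N:ℝ)/(1 + (Real.exp β - 1) * ((N:ℝ) - 1) ^ 2))))) := by
  have hpm : Measurable p := hmono.measurable
  have hN0 : (0 : ℝ) < N := by positivity
  have hN1 : (1 : ℝ) ≤ N := by exact_mod_cast (by omega : 1 ≤ N)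
  have hMx : ∀ x, Measurable (M x) := fun x => hM.comp measurable_prodMk_left
  have hw : Measurable (fun q : ℕ × ℕ => ENNReal.ofReal
      ((1 - 1/(N:ℝ)) ^ q.1 * (if q.1 ≤ q.2 then 1 else 0) / Real.exp (-β * q.1))) :=
    measurable_of_countable _
  rw [lintegral_sq_lintegral_Ioi]
  · congr 1
    refine setLIntegral_congr_fun measurableSet_Ioi fun x _ => ?_
    refine setLIntegral_congr_fun measurableSet_Ioo fun y hy => ?_
    rcases (hp0 x).eq_or_lt with hx | hx
    · simp [← hx]
    have hxy : p x ≤ p y := hmono hy.2.le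
    have hy0 : 0 < p y := hx.trans_le hxy
    simp_rw [if_neg hx.ne', if_neg hy0.ne']
    have hr : 0 ≤ -((N:ℝ) * Real.log (p y)) := by
      have := Real.log_nonpos (hp0 y) (hp1 y)
      nlinarith
    have hs : 0 ≤ -((N:ℝ) * Real.log (p x / p y)) := by
      have := Real.log_nonpos (div_pos hx hy0).le ((div_le_one hy0).2 hxy)
      nlinarith
    have hc : 0 ≤ 1 - 1/(N:ℝ) := sub_nonneg.2 ((div_le_one hN0).2 hN1)
    rw [lintegral_randomised_weight_mul ℙ hc hβ hr hs (hMx y) (hMx x) hT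
      (fun k l n => by simpa only [neg_neg] using hlaw y x hy.1 hy.2 hx k l n)]
    congr 1
    rw [Real.rpow_def_of_pos hy0, ← Real.exp_add]
    conv_rhs => rw [← Real.exp_log hx, ← Real.exp_add]
    rw [Real.log_div hx.ne' hy0.ne', one_div_div]
    congr 1
    field_simp
    ring
  · exact Measurable.ite ((measurableSet_singleton (0 : ℝ)).preimage (hpm.comp measurable_fst))
      measurable_const (hw.comp (hM.prodMk (hT.comp measurable_snd)))
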